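/- Let N be a positive integer, let a be an integer with 1 ≤ a ≤ N, and let r be a real number. Then there exists ε > 0 such that for all real u, v, w with |u|, |v|, |w| < ε, the function Φ₀^r(z) = Φ₀^r(u,v,w;z) is twice differentiable on the real interval 0 < z < 1 and satisfies the differential equation z²(1−z^N)(Φ₀^r)'' + z[(1−u)(1−z^N) − v(r+(1−r)z^N)](Φ₀^r)' + (r+(1−r)z^N)(uv−w²)Φ₀^r = z^a. -/

import Mathlib

/-- All groupings of an index obtained by replacing each box in
`k₁ □ k₂ □ ⋯ □ kₙ` by a comma (new block) or a plus (merge). -/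
def groupings : List ℕ → List (List ℕ)
  | [] => [[]]
  | [x] => [[x]]
  | x :: y :: rest => ((groupings (y :: rest)).map (x :: ·)) ++ groupings ((x + y) :: rest)
termination_by l => l.length

/-- The one-variable function
`L_{N,a}(k; z) = Σ_{m₁ > ⋯ > mₙ > 0, mᵢ ≡ a (mod N)} z^{m₁}/(m₁^{k₁} ⋯ mₙ^{kₙ})`. -/
noncomputable def Lv (N a : ℕ) (k : List ℕ) (z : ℝ) : ℝ :=
  ∑' m : {f : Fin k.length → ℕ // StrictAnti f ∧ ∀ i, 0 < f i ∧ f i % N = a % N},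
    (if h : 0 < k.length then z ^ (m.1 ⟨0, h⟩) else 1) *
      ∏ i : Fin k.length, ((m.1 i : ℝ) ^ k.get i)⁻¹

/-- The interpolated function `L^r_{N,a}(k; z) = Σ_p r^{n - dep(p)} L_{N,a}(p; z)`
over all groupings `p` of `k`. -/
noncomputable def iLv (N a : ℕ) (r : ℝ) (k : List ℕ) (z : ℝ) : ℝ :=
  ((groupings k).map (fun p => r ^ (k.length - p.length) * Lv N a p z)).sum

/-- An index is admissible if all entries are positive and the first entry is at least `2`. -/
def IsAdmissible (k : List ℕ) : Prop := (∀ i ∈ k, 1 ≤ i) ∧ 2 ≤ k.headI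

/-- The height of an index: the number of entries that are at least `2`. -/
def height (k : List ℕ) : ℕ := k.countP (fun i => 2 ≤ i)

/-- `X₀^r(k,n,s;z)`: sum of `L^r_{N,a}(k;z)` over all admissible indices of
weight `k`, depth `n` and height `s`. -/
noncomputable def X0z (N a : ℕ) (r : ℝ) (k n s : ℕ) (z : ℝ) : ℝ :=
  ∑' l : {l : List ℕ // IsAdmissible l ∧ l.sum = k ∧ l.length = n ∧ height l = s},
    iLv N a r l.1 z

/-- `X^r(k,n,s;z)`: sum of `L^r_{N,a}(k;z)` over all indices of
weight `k`, depth `n` and height `s`. -/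
noncomputable def Xz (N a : ℕ) (r : ℝ) (k n s : ℕ) (z : ℝ) : ℝ :=
  ∑' l : {l : List ℕ // (∀ i ∈ l, 1 ≤ i) ∧ l.sum = k ∧ l.length = n ∧ height l = s},
    iLv N a r l.1 z

/-- The generating function
`Φ₀^r(u,v,w;z) = Σ_{k,n,s} X₀^r(k,n,s;z) u^{k-n-s} v^{n-s} w^{2s-2}`
(the only nonzero contributions have `k ≥ n+s` and `n ≥ s ≥ 1`). -/
noncomputable def Phi0 (N a : ℕ) (r u v w : ℝ) (z : ℝ) : ℝ :=
  ∑' p : ℕ × ℕ × ℕ,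
    if p.2.1 + p.2.2 ≤ p.1 ∧ p.2.2 ≤ p.2.1 ∧ 1 ≤ p.2.2 then
      X0z N a r p.1 p.2.1 p.2.2 z * u ^ (p.1 - p.2.1 - p.2.2) * v ^ (p.2.1 - p.2.2)
        * w ^ (2 * p.2.2 - 2)
    else 0

section

open Finset

/-- `m ^ (-x)` when `m` is a positive integer congruent to `a` modulo `N`, and `0` otherwise. -/
noncomputable def residueInv (N a m x : ℕ) : ℝ :=
  if 0 < m ∧ m % N = a % N then ((m : ℝ) ^ x)⁻¹ else 0

/-- The truncated nested sum `∑_{M > m₁ > ⋯ > mₙ} χ m₁ k₁ ⋯ χ mₙ kₙ`. -/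
noncomputable def truncSum (χ : ℕ → ℕ → ℝ) : List ℕ → ℕ → ℝ
  | [], _ => 1
  | x :: ks, M => ∑ m ∈ range M, χ m x * truncSum χ ks m

/-- The part of the nested sum indexed by `k` whose largest variable is equal to `m`. -/
noncomputable def leadTerm (χ : ℕ → ℕ → ℝ) : List ℕ → ℕ → ℝ
  | [], _ => 0
  | x :: ks, m => χ m x * truncSum χ ks m

/-- The nested sum over `M ≥ m₁ ≥ ⋯ ≥ mₙ` in which every equality sign, including `M = m₁`,
carries a factor `r`. -/
noncomputable def interpSum (χ : ℕ → ℕ → ℝ) (r : ℝ) : List ℕ → ℕ → ℝ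
  | [], _ => 1
  | x :: ks, M =>
    ∑ m ∈ range M, χ m x * interpSum χ r ks m + r * (χ M x * interpSum χ r ks M)

theorem residueInv_nonneg (N a m x : ℕ) : 0 ≤ residueInv N a m x := by
  unfold residueInv
  split_ifs <;> positivity

theorem residueInv_le_one (N a m x : ℕ) : residueInv N a m x ≤ 1 := by
  unfold residueInv
  split_ifs with h
  · exact inv_le_one_of_one_le₀ (one_le_pow₀ (by exact_mod_cast h.1))
  · exact zero_le_one

theorem residueInv_add (N a m x y : ℕ) :
    residueInv N a m (x + y) = residueInv N a m x * residueInv N a m y := by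
  unfold residueInv
  split_ifs
  · rw [pow_add, mul_inv]
  · simp

theorem truncSum_nonneg {χ : ℕ → ℕ → ℝ} (hχ : ∀ m x, 0 ≤ χ m x) (ks : List ℕ) (M : ℕ) :
    0 ≤ truncSum χ ks M := by
  induction ks generalizing M with
  | nil => simp [truncSum]
  | cons x ks ih => exact sum_nonneg fun m _ => mul_nonneg (hχ m x) (ih m)

theorem truncSum_le_pow {χ : ℕ → ℕ → ℝ} (hχ : ∀ m x, 0 ≤ χ m x) (hχ' : ∀ m x, χ m x ≤ 1)
    (ks : List ℕ) (M : ℕ) : truncSum χ ks M ≤ (M : ℝ) ^ ks.length := by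
  induction ks generalizing M with
  | nil => simp [truncSum]
  | cons x ks ih =>
    calc truncSum χ (x :: ks) M ≤ ∑ _m ∈ range M, (M : ℝ) ^ ks.length := by
          refine sum_le_sum fun m hm => ?_
          have h1 : (m : ℝ) ≤ M := by exact_mod_cast (mem_range.1 hm).le
          calc χ m x * truncSum χ ks m ≤ 1 * (m : ℝ) ^ ks.length :=
                mul_le_mul (hχ' m x) (ih m) (truncSum_nonneg hχ ks m) zero_le_one
            _ ≤ (M : ℝ) ^ ks.length := by rw [one_mul]; gcongr
      _ = (M : ℝ) ^ (x :: ks).length := by simp [pow_succ']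

theorem HasSum.of_eq {ι : Type*} {f g : ι → ℝ} {s t : ℝ} (h : HasSum f s) (hf : ∀ i, g i = f i)
    (hs : t = s) : HasSum g t := by
  rwa [hs, funext hf]

theorem HasSum.const_mul_prod {α β : Type*} {f : α → ℝ} {g : β → ℝ} {s t : ℝ} (hf : HasSum f s)
    (hg : HasSum g t) (c : ℝ) :
    HasSum (fun p : α × β => c * (f p.1 * g p.2)) (s * t * c) := by
  rw [mul_comm _ c]
  have h := hf.mul hg (summable_mul_of_summable_norm hf.summable.norm hg.summable.norm)
  exact h.mul_left c

theorem hasSum_prod_of_nonneg {α β : Type*} {f : α × β → ℝ} {g : α → ℝ} {s : ℝ} (hf : 0 ≤ f)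
    (hg : ∀ x, HasSum (fun y => f (x, y)) (g x)) (hs : HasSum g s) : HasSum f s := by
  have hsum : Summable f := (summable_prod_of_nonneg hf).2
    ⟨fun x => (hg x).summable, by simpa only [(hg _).tsum_eq] using hs.summable⟩
  exact (hsum.hasSum.prod_fiberwise hg).unique hs ▸ hsum.hasSum

theorem strictAnti_fin_cons {n m : ℕ} {g : Fin n → ℕ} :
    StrictAnti (Fin.cons m g : Fin (n + 1) → ℕ) ↔ (∀ i, g i < m) ∧ StrictAnti g := by
  constructor
  · intro h
    exact ⟨fun i => by simpa using h (Fin.succ_pos i),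
      fun i j hij => by simpa using h (Fin.succ_lt_succ_iff.2 hij)⟩
  · rintro ⟨h1, h2⟩ i j hij
    induction i using Fin.cases with
    | zero =>
      induction j using Fin.cases with
      | zero => exact absurd hij (lt_irrefl _)
      | succ j => simpa using h1 j
    | succ i =>
      induction j using Fin.cases with
      | zero => exact absurd hij (by simp)
      | succ j => simpa using h2 (Fin.succ_lt_succ_iff.1 hij)

open Classical in
theorem hasSum_strictAnti_cons {N a : ℕ} (x : ℕ) {ks : List ℕ}
    (hks : ∀ m, HasSum (fun f : Fin ks.length → ℕ =>
      if StrictAnti f ∧ (∀ i, 0 < f i ∧ f i % N = a % N) ∧ ∀ i, f i < m then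
        ∏ i, ((f i : ℝ) ^ ks.get i)⁻¹ else 0) (truncSum (residueInv N a) ks m))
    {φ : ℕ → ℝ} (hφ : ∀ m, 0 ≤ φ m) {s : ℝ}
    (hs : HasSum (fun m => φ m * leadTerm (residueInv N a) (x :: ks) m) s) :
    HasSum (fun f : Fin (x :: ks).length → ℕ =>
      if StrictAnti f ∧ ∀ i, 0 < f i ∧ f i % N = a % N then
        φ (f ⟨0, Nat.succ_pos _⟩) * ∏ i, ((f i : ℝ) ^ (x :: ks).get i)⁻¹ else 0) s := by
  refine (Fin.consEquiv (fun _ : Fin (ks.length + 1) => ℕ)).hasSum_iff.1 ?_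
  have key : ∀ p : ℕ × (Fin ks.length → ℕ), ((fun f : Fin (x :: ks).length → ℕ =>
      if StrictAnti f ∧ ∀ i, 0 < f i ∧ f i % N = a % N then
        φ (f ⟨0, Nat.succ_pos _⟩) * ∏ i, ((f i : ℝ) ^ (x :: ks).get i)⁻¹ else 0) ∘
      (Fin.consEquiv (fun _ : Fin (ks.length + 1) => ℕ))) p
      = φ p.1 * residueInv N a p.1 x *
        if StrictAnti p.2 ∧ (∀ i, 0 < p.2 i ∧ p.2 i % N = a % N) ∧ ∀ i, p.2 i < p.1 then
          ∏ i, ((p.2 i : ℝ) ^ ks.get i)⁻¹ else 0 := by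
    rintro ⟨m, g⟩
    have hz : (⟨0, Nat.succ_pos _⟩ : Fin (ks.length + 1)) = 0 := rfl
    simp only [Function.comp, Fin.consEquiv, Equiv.coe_fn_mk, List.length_cons,
      strictAnti_fin_cons, Fin.forall_fin_succ, Fin.prod_univ_succ, Fin.cons_zero, Fin.cons_succ,
      residueInv, List.get_cons_zero, hz]
    by_cases h1 : 0 < m ∧ m % N = a % N <;> by_cases h2 : StrictAnti g <;>
      by_cases h3 : ∀ i, 0 < g i ∧ g i % N = a % N <;> by_cases h4 : ∀ i, g i < m <;>
      simp only [h1, h2, h3, h4] <;> simp [mul_assoc]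
  refine hasSum_prod_of_nonneg (g := fun m => φ m * leadTerm (residueInv N a) (x :: ks) m)
    (fun p => ?_) (fun m => ?_) hs
  · rw [key]
    refine mul_nonneg (mul_nonneg (hφ _) (residueInv_nonneg ..)) ?_
    split_ifs
    · exact prod_nonneg fun i _ => by positivity
    · exact le_rfl
  · simp only [key, leadTerm, ← mul_assoc]
    exact (hks m).mul_left _

open Classical in
theorem hasSum_truncSum (N a : ℕ) (ks : List ℕ) (M : ℕ) :
    HasSum (fun f : Fin ks.length → ℕ =>
      if StrictAnti f ∧ (∀ i, 0 < f i ∧ f i % N = a % N) ∧ ∀ i, f i < M then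
        ∏ i, ((f i : ℝ) ^ ks.get i)⁻¹ else 0) (truncSum (residueInv N a) ks M) := by
  induction ks generalizing M with
  | nil =>
    refine HasSum.of_eq (f := fun _ : Fin 0 → ℕ => (1 : ℝ)) (s := 1)
      (by simp) (fun f => ?_) rfl
    rw [if_pos ⟨fun i => i.elim0, fun i => i.elim0, fun i => i.elim0⟩]
    rfl
  | cons x ks ih =>
    have hs : HasSum (fun m => (if m < M then 1 else 0) * leadTerm (residueInv N a) (x :: ks) m)
        (truncSum (residueInv N a) (x :: ks) M) := by
      have := hasSum_sum_of_ne_finset_zero (s := range M)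
        (L := .unconditional _) (f := fun m => (if m < M then 1 else 0) * leadTerm (residueInv N a) (x :: ks) m)
        (fun m hm => by simp [mem_range.not.1 hm])
      convert this using 1
      refine sum_congr rfl fun m hm => ?_
      simp [mem_range.1 hm, leadTerm]
    have := hasSum_strictAnti_cons x ih (φ := fun m => if m < M then 1 else 0)
      (fun m => by split_ifs <;> norm_num) hs
    convert this using 2 with f
    by_cases h1 : StrictAnti f
    · have h2 : (∀ i, f i < M) ↔ f ⟨0, Nat.succ_pos _⟩ < M :=
        ⟨fun h => h _, fun h i => (h1.antitone (Fin.mk_le_of_le_val (Nat.zero_le _))).trans_lt h⟩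
      by_cases h3 : ∀ i, 0 < f i ∧ f i % N = a % N <;>
        by_cases h4 : f ⟨0, Nat.succ_pos _⟩ < M <;> simp only [h1, h2, h3, h4] <;> simp
    · simp [h1]

theorem hasSum_Lv (N a x : ℕ) (ks : List ℕ) {z : ℝ} (hz0 : 0 ≤ z) (hz1 : z < 1) :
    HasSum (fun m => z ^ m * leadTerm (residueInv N a) (x :: ks) m) (Lv N a (x :: ks) z) := by
  classical
  have hsum : Summable fun m => z ^ m * leadTerm (residueInv N a) (x :: ks) m := by
    refine Summable.of_nonneg_of_le (fun m => mul_nonneg (by positivity)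
      (mul_nonneg (residueInv_nonneg ..) (truncSum_nonneg (residueInv_nonneg N a) _ _)))
      (fun m => ?_) (summable_pow_mul_geometric_of_norm_lt_one ks.length
        (by rwa [Real.norm_of_nonneg hz0]))
    rw [mul_comm]
    gcongr
    calc residueInv N a m x * truncSum (residueInv N a) ks m ≤ 1 * (m : ℝ) ^ ks.length :=
          mul_le_mul (residueInv_le_one ..)
            (truncSum_le_pow (residueInv_nonneg N a) (residueInv_le_one N a) _ _)
            (truncSum_nonneg (residueInv_nonneg N a) _ _) zero_le_one
      _ = (m : ℝ) ^ ks.length := one_mul _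
  have := hasSum_strictAnti_cons x (hasSum_truncSum N a ks) (φ := fun m => z ^ m)
    (fun m => by positivity) hsum.hasSum
  have h2 : Lv N a (x :: ks) z = ∑' m, z ^ m * leadTerm (residueInv N a) (x :: ks) m := by
    rw [← this.tsum_eq, Lv]
    refine (tsum_subtype {f : Fin (x :: ks).length → ℕ |
      StrictAnti f ∧ ∀ i, 0 < f i ∧ f i % N = a % N} (fun f => (if h : 0 < (x :: ks).length then
        z ^ (f ⟨0, h⟩) else 1) * ∏ i, ((f i : ℝ) ^ (x :: ks).get i)⁻¹)).trans ?_
    refine tsum_congr fun f => ?_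
    simp [Set.indicator_apply]
  rw [h2]
  exact hsum.hasSum

theorem groupings_cons_ne_nil_and_length_le (ks : List ℕ) (x : ℕ) {p : List ℕ}
    (hp : p ∈ groupings (x :: ks)) : p ≠ [] ∧ p.length ≤ ks.length + 1 := by
  induction ks generalizing x p with
  | nil =>
    rw [groupings, List.mem_singleton] at hp
    simp [hp]
  | cons y ks ih =>
    rw [groupings, List.mem_append, List.mem_map] at hp
    rcases hp with ⟨q, hq, rfl⟩ | hp
    · simp [(ih y hq).2]
    · refine ⟨(ih _ hp).1, (ih _ hp).2.trans ?_⟩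
      simp

theorem truncSum_eq_sum_leadTerm (χ : ℕ → ℕ → ℝ) {p : List ℕ} (hp : p ≠ []) (M : ℕ) :
    truncSum χ p M = ∑ m ∈ range M, leadTerm χ p m := by
  cases p with
  | nil => exact absurd rfl hp
  | cons x ks => rfl

theorem List.sum_map_finset_sum {α ι : Type*} (l : List α) (s : Finset ι) (f : α → ι → ℝ) :
    (l.map fun p => ∑ i ∈ s, f p i).sum = ∑ i ∈ s, (l.map fun p => f p i).sum := by
  induction l with
  | nil => simp
  | cons p l ih => simp [ih, sum_add_distrib]

theorem List.hasSum_sum_map {α ι : Type*} (l : List α) {f : α → ι → ℝ} {g : α → ℝ}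
    (h : ∀ p ∈ l, HasSum (f p) (g p)) :
    HasSum (fun i => (l.map fun p => f p i).sum) (l.map g).sum := by
  induction l with
  | nil => simp [hasSum_zero]
  | cons p l ih =>
    simpa using (h p (by simp)).add (ih fun q hq => h q (by simp [hq]))

theorem sum_groupings_leadTerm {χ : ℕ → ℕ → ℝ} (hχ : ∀ m x y, χ m (x + y) = χ m x * χ m y)
    (r : ℝ) (ks : List ℕ) (x m : ℕ) :
    ((groupings (x :: ks)).map fun p => r ^ ((x :: ks).length - p.length) * leadTerm χ p m).sum
      = χ m x * interpSum χ r ks m := by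
  induction ks generalizing x m with
  | nil => simp [groupings, leadTerm, truncSum, interpSum]
  | cons y ks ih =>
    have h1 : ((groupings (y :: ks)).map fun p =>
        r ^ ((x :: y :: ks).length - (x :: p).length) * leadTerm χ (x :: p) m).sum
        = χ m x * ∑ m' ∈ range m, χ m' y * interpSum χ r ks m' := by
      simp only [← ih]
      rw [← List.sum_map_finset_sum, ← List.sum_map_mul_left]
      refine congrArg List.sum (List.map_congr_left fun p hp => ?_)
      rw [leadTerm, truncSum_eq_sum_leadTerm χ (groupings_cons_ne_nil_and_length_le _ _ hp).1,
        ← mul_sum]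
      simp only [List.length_cons, Nat.add_sub_add_right]
      ring
    have h2 : ((groupings ((x + y) :: ks)).map fun p =>
        r ^ ((x :: y :: ks).length - p.length) * leadTerm χ p m).sum
        = r * (χ m (x + y) * interpSum χ r ks m) := by
      rw [← ih, ← List.sum_map_mul_left]
      refine congrArg List.sum (List.map_congr_left fun p hp => ?_)
      have := (groupings_cons_ne_nil_and_length_le _ _ hp).2
      have h3 : (x :: y :: ks).length - p.length = ((x + y) :: ks).length - p.length + 1 := by
        simp only [List.length_cons]
        omega
      rw [h3, pow_succ]
      ring
    rw [groupings, List.map_append, List.sum_append, List.map_map]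
    simp only [Function.comp_def]
    rw [h1, h2, hχ, interpSum]
    ring

theorem hasSum_iLv (N a : ℕ) (r : ℝ) (x : ℕ) (ks : List ℕ) {z : ℝ} (hz0 : 0 ≤ z) (hz1 : z < 1) :
    HasSum (fun m => z ^ m * (residueInv N a m x * interpSum (residueInv N a) r ks m))
      (iLv N a r (x :: ks) z) := by
  simp only [← sum_groupings_leadTerm (residueInv_add N a), ← List.sum_map_mul_left]
  refine List.hasSum_sum_map _ fun p hp => ?_
  obtain ⟨y, l, rfl⟩ :=
    List.exists_cons_of_ne_nil (groupings_cons_ne_nil_and_length_le _ _ hp).1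
  simpa only [mul_left_comm] using
    (hasSum_Lv N a y l hz0 hz1).mul_left (r ^ ((x :: ks).length - (y :: l).length))

theorem interpSum_nonneg {χ : ℕ → ℕ → ℝ} (hχ : ∀ m x, 0 ≤ χ m x) {r : ℝ} (hr : 0 ≤ r)
    (ks : List ℕ) (M : ℕ) : 0 ≤ interpSum χ r ks M := by
  induction ks generalizing M with
  | nil => simp [interpSum]
  | cons x ks ih =>
    exact add_nonneg (sum_nonneg fun m _ => mul_nonneg (hχ m x) (ih m))
      (mul_nonneg hr (mul_nonneg (hχ M x) (ih M)))

theorem abs_interpSum_le {χ : ℕ → ℕ → ℝ} (hχ : ∀ m x, 0 ≤ χ m x) (r : ℝ)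
    (ks : List ℕ) (M : ℕ) : |interpSum χ r ks M| ≤ interpSum χ |r| ks M := by
  induction ks generalizing M with
  | nil => simp [interpSum]
  | cons x ks ih =>
    refine (abs_add_le _ _).trans (add_le_add ((abs_sum_le_sum_abs _ _).trans
      (sum_le_sum fun m _ => ?_)) ?_)
    · rw [abs_mul, abs_of_nonneg (hχ m x)]
      exact mul_le_mul_of_nonneg_left (ih m) (hχ m x)
    · rw [abs_mul, abs_mul, abs_of_nonneg (hχ M x)]
      exact mul_le_mul_of_nonneg_left (mul_le_mul_of_nonneg_left (ih M) (hχ M x)) (abs_nonneg r)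

/-- The weight of a non-leading entry of an index in the generating function. -/
def letterWeight (u v w : ℝ) : ℕ → ℝ
  | 0 => 0
  | 1 => v
  | x + 2 => u ^ x * w ^ 2

/-- The weight of the leading entry of an index in the generating function of admissible
indices. -/
def headWeight (u : ℝ) : ℕ → ℝ
  | 0 => 0
  | 1 => 0
  | x + 2 => u ^ x

/-- The product of the weights of the entries of a list. -/
noncomputable def listWeight (u v w : ℝ) (l : List ℕ) : ℝ := (l.map (letterWeight u v w)).prod

theorem abs_letterWeight (u v w : ℝ) (x : ℕ) :
    |letterWeight u v w x| = letterWeight |u| |v| |w| x := by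
  match x with
  | 0 => simp [letterWeight]
  | 1 => rfl
  | x + 2 => simp [letterWeight, abs_mul, abs_pow]

theorem abs_headWeight (u : ℝ) (x : ℕ) : |headWeight u x| = headWeight |u| x := by
  match x with
  | 0 => simp [headWeight]
  | 1 => simp [headWeight]
  | x + 2 => simp [headWeight, abs_pow]

theorem listWeight_cons (u v w : ℝ) (x : ℕ) (l : List ℕ) :
    listWeight u v w (x :: l) = letterWeight u v w x * listWeight u v w l := by
  simp [listWeight]

theorem abs_listWeight (u v w : ℝ) (l : List ℕ) :
    |listWeight u v w l| = listWeight |u| |v| |w| l := by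
  induction l with
  | nil => simp [listWeight]
  | cons x l ih => rw [listWeight_cons, listWeight_cons, abs_mul, ih, abs_letterWeight]

/-- The sum of all head weights against `residueInv N a m`. -/
noncomputable def headSum (N a : ℕ) (u : ℝ) (m : ℕ) : ℝ :=
  if 0 < m ∧ m % N = a % N then ((m : ℝ) * (m - u))⁻¹ else 0

/-- The sum of all letter weights against `residueInv N a m`. -/
noncomputable def letterSum (N a : ℕ) (u v w : ℝ) (m : ℕ) : ℝ :=
  if 0 < m ∧ m % N = a % N then v / m + w ^ 2 * ((m : ℝ) * (m - u))⁻¹ else 0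

theorem hasSum_headWeight (N a : ℕ) {u : ℝ} (hu : |u| < 1) (m : ℕ) :
    HasSum (fun x => headWeight u x * residueInv N a m x) (headSum N a u m) := by
  unfold residueInv headSum
  split_ifs with h
  · have hm : (1 : ℝ) ≤ m := by exact_mod_cast h.1
    have hmu : 0 < (m : ℝ) - u := by linarith [(abs_lt.1 hu).2]
    have hlt : |u / m| < 1 := by
      rw [abs_div, abs_of_pos (by linarith : (0 : ℝ) < m), div_lt_one (by linarith)]
      linarith
    have h1 := (hasSum_geometric_of_abs_lt_one hlt).mul_left (((m : ℝ) ^ 2)⁻¹)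
    rw [← hasSum_nat_add_iff' 2]
    refine h1.of_eq (fun x => ?_) ?_
    · simp only [headWeight]
      rw [pow_add, div_pow]
      field_simp
    · simp only [sum_range_succ, range_zero, sum_empty, headWeight]
      have : (1 : ℝ) - u / m ≠ 0 := by
        have := (abs_lt.1 hlt).2
        linarith
      field_simp
      ring
  · simp [hasSum_zero]

theorem hasSum_letterWeight (N a : ℕ) {u : ℝ} (hu : |u| < 1) (v w : ℝ) (m : ℕ) :
    HasSum (fun x => letterWeight u v w x * residueInv N a m x) (letterSum N a u v w m) := by
  have h1 := ((hasSum_headWeight N a hu m).mul_left (w ^ 2)).add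
    (hasSum_ite_eq 1 (v * residueInv N a m 1))
  refine h1.of_eq (fun x => ?_) ?_
  · match x with
    | 0 => simp [letterWeight, headWeight]
    | 1 => simp [letterWeight, headWeight]
    | x + 2 =>
      simp [letterWeight, headWeight]
      ring
  · unfold letterSum headSum residueInv
    split_ifs
    · rw [pow_one]
      ring
    · simp

theorem hasSum_list_of_hasSum_cons {f : List ℕ → ℝ} {s : ℝ}
    (h : HasSum (fun p : ℕ × List ℕ => f (p.1 :: p.2)) s) : HasSum f (f [] + s) := by
  have hinj : Function.Injective fun p : ℕ × List ℕ => p.1 :: p.2 := by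
    rintro ⟨x, l⟩ ⟨y, l'⟩ h
    simpa using h
  have h1 : HasSum (fun l => if l = [] then 0 else f l) s := by
    refine (hinj.hasSum_iff fun l hl => ?_).1 (h.of_eq (fun p => ?_) rfl)
    · cases l with
      | nil => simp
      | cons x l => exact absurd ⟨(x, l), rfl⟩ hl
    · simp
  refine ((hasSum_ite_eq ([] : List ℕ) (f [])).add h1).of_eq (fun l => ?_) rfl
  by_cases hl : l = [] <;> simp [hl]

theorem hasSum_cons_interpSum {χ : ℕ → ℕ → ℝ} {r : ℝ} {γ g : ℕ → ℝ}
    (hg : ∀ m, HasSum (fun x => γ x * χ m x) (g m)) {φ : List ℕ → ℝ} {F : ℕ → ℝ}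
    (hF : ∀ m, HasSum (fun ks => φ ks * interpSum χ r ks m) (F m)) (m : ℕ) :
    HasSum (fun p : ℕ × List ℕ => γ p.1 * φ p.2 * interpSum χ r (p.1 :: p.2) m)
      (∑ m' ∈ range m, g m' * F m' + r * (g m * F m)) := by
  have hprod : ∀ k, HasSum (fun p : ℕ × List ℕ =>
      γ p.1 * χ k p.1 * (φ p.2 * interpSum χ r p.2 k)) (g k * F k) := fun k =>
    (hg k).mul (hF k) (summable_mul_of_summable_norm (hg k).summable.norm (hF k).summable.norm)
  refine ((hasSum_sum fun k (_ : k ∈ range m) => hprod k).add ((hprod m).mul_left r)).of_eq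
    (fun p => ?_) rfl
  rw [interpSum, mul_add, mul_sum]
  congr 1
  · exact sum_congr rfl fun k _ => by ring
  · ring

theorem interpSum_weighted_truncation_le {χ : ℕ → ℕ → ℝ} {r u v w : ℝ} {g : ℕ → ℝ}
    (hχ : ∀ m x, 0 ≤ χ m x) (hr : 0 ≤ r) (hu : 0 ≤ u) (hv : 0 ≤ v)
    (hw : 0 ≤ w) (hg : ∀ m, HasSum (fun x => letterWeight u v w x * χ m x) (g m))
    (hg1 : ∀ m : ℕ, g m * (2 * (m + 1)) ≤ 1) (hg2 : ∀ m : ℕ, r * (g m * (2 * (m + 1))) ≤ 1)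
    (n : ℕ) : ∃ F : ℕ → ℝ, ∀ m : ℕ,
      HasSum (fun l => (if l.length ≤ n then listWeight u v w l else 0) * interpSum χ r l m) (F m)
      ∧ F m ≤ 2 * (m + 1) := by
  induction n with
  | zero =>
    refine ⟨fun _ => 1, fun m => ⟨?_, ?_⟩⟩
    · refine (hasSum_ite_eq ([] : List ℕ) (1 : ℝ)).of_eq (fun l => ?_) rfl
      cases l <;> simp [listWeight, interpSum]
    · have : (0 : ℝ) ≤ m := m.cast_nonneg
      linarith
  | succ n ih =>
    obtain ⟨F, hF⟩ := ih
    have hg0 : ∀ m, 0 ≤ g m := fun m => (hg m).nonneg fun x => by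
      rw [← abs_of_nonneg hu, ← abs_of_nonneg hv, ← abs_of_nonneg hw, ← abs_letterWeight]
      exact mul_nonneg (abs_nonneg _) (hχ m x)
    have hgF : ∀ m, g m * F m ≤ g m * (2 * (m + 1)) := fun m =>
      mul_le_mul_of_nonneg_left (hF m).2 (hg0 m)
    refine ⟨fun m => 1 + (∑ m' ∈ range m, g m' * F m' + r * (g m * F m)), fun m => ⟨?_, ?_⟩⟩
    · have h := hasSum_list_of_hasSum_cons (f := fun l =>
        (if l.length ≤ n + 1 then listWeight u v w l else 0) * interpSum χ r l m)
        ((hasSum_cons_interpSum hg (fun m => (hF m).1) m).of_eq (fun p => ?_) rfl)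
      · simpa [listWeight, interpSum] using h
      · simp only [List.length_cons, Nat.add_le_add_iff_right, listWeight_cons, mul_ite, mul_zero]
    · have h1 : ∑ m' ∈ range m, g m' * F m' ≤ m := by
        calc ∑ m' ∈ range m, g m' * F m' ≤ ∑ _m' ∈ range m, (1 : ℝ) :=
              sum_le_sum fun k _ => (hgF k).trans (hg1 k)
          _ = m := by simp
      have h2 : r * (g m * F m) ≤ 1 := (mul_le_mul_of_nonneg_left (hgF m) hr).trans (hg2 m)
      have : (0 : ℝ) ≤ m := m.cast_nonneg
      linarith

theorem hasSum_listWeight_mul_interpSum_of_nonneg {χ : ℕ → ℕ → ℝ} {r u v w : ℝ} {g : ℕ → ℝ}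
    (hχ : ∀ m x, 0 ≤ χ m x) (hr : 0 ≤ r) (hu : 0 ≤ u) (hv : 0 ≤ v)
    (hw : 0 ≤ w) (hg : ∀ m, HasSum (fun x => letterWeight u v w x * χ m x) (g m))
    (hg1 : ∀ m : ℕ, g m * (2 * (m + 1)) ≤ 1) (hg2 : ∀ m : ℕ, r * (g m * (2 * (m + 1))) ≤ 1)
    (m : ℕ) : ∃ F, HasSum (fun l => listWeight u v w l * interpSum χ r l m) F ∧
      F ≤ 2 * (m + 1) := by
  have hW : ∀ l, 0 ≤ listWeight u v w l := fun l => by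
    rw [← abs_of_nonneg hu, ← abs_of_nonneg hv, ← abs_of_nonneg hw, ← abs_listWeight]
    exact abs_nonneg _
  have hT := interpSum_nonneg hχ hr
  have hbound : ∀ s : Finset (List ℕ),
      ∑ l ∈ s, listWeight u v w l * interpSum χ r l m ≤ 2 * (m + 1) := by
    intro s
    obtain ⟨F, hF⟩ := interpSum_weighted_truncation_le hχ hr hu hv hw hg hg1 hg2
      (s.sup List.length)
    refine le_trans ?_ (hF m).2
    refine le_trans (le_of_eq ?_) (sum_le_hasSum s (fun l _ => ?_) (hF m).1)
    · refine sum_congr rfl fun l hl => ?_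
      rw [if_pos (le_sup (f := List.length) hl)]
    · refine mul_nonneg ?_ (hT l m)
      split_ifs
      exacts [hW l, le_rfl]
  have hsum := summable_of_sum_le (fun l => mul_nonneg (hW l) (hT l m)) hbound
  exact ⟨_, hsum.hasSum, hsum.tsum_le_of_sum_le hbound⟩

theorem letterSum_mul_le {N a : ℕ} {u v w ε : ℝ} (hε : ε ≤ 1 / 12) (hu0 : 0 ≤ u)
    (hw0 : 0 ≤ w) (hu : u ≤ ε) (hv : v ≤ ε) (hw : w ≤ ε) (m : ℕ) :
    letterSum N a u v w m * (2 * (m + 1)) ≤ 12 * ε := by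
  unfold letterSum
  split_ifs with h
  · have hm : (1 : ℝ) ≤ m := by exact_mod_cast h.1
    have hmu : (1 : ℝ) / 2 ≤ m - u := by linarith
    have h1 : ((m : ℝ) * (m - u))⁻¹ ≤ 2 / m := by
      rw [inv_eq_one_div, div_le_div_iff₀ (by nlinarith) (by linarith)]
      nlinarith
    have hw2 : w ^ 2 ≤ ε := by nlinarith
    have hε0 : 0 ≤ ε := hu0.trans hu
    have h0 : 0 ≤ ((m : ℝ) * (m - u))⁻¹ := inv_nonneg.2 (by nlinarith)
    have h2 : v / m + w ^ 2 * ((m : ℝ) * (m - u))⁻¹ ≤ 3 * ε / m := by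
      calc v / m + w ^ 2 * ((m : ℝ) * (m - u))⁻¹ ≤ ε / m + ε * (2 / m) := by gcongr
        _ = 3 * ε / m := by ring
    calc _ ≤ 3 * ε / m * (2 * (m + 1)) := by gcongr
      _ ≤ 3 * ε / m * (2 * (m + m)) := by gcongr
      _ = 12 * ε := by field_simp; ring
  · linarith

theorem headSum_mul_le {N a : ℕ} {u : ℝ} (hu : u ≤ 1 / 2) (m : ℕ) :
    0 ≤ headSum N a u m ∧ headSum N a u m * (2 * (m + 1)) ≤ 8 := by
  unfold headSum
  split_ifs with h
  · have hm : (1 : ℝ) ≤ m := by exact_mod_cast h.1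
    have hmu : (1 : ℝ) / 2 ≤ m - u := by linarith
    refine ⟨inv_nonneg.2 (by nlinarith), ?_⟩
    rw [inv_mul_le_iff₀ (by nlinarith)]
    nlinarith
  · simp

theorem listWeight_eq_of_pos (u v w : ℝ) {l : List ℕ} (hl : ∀ x ∈ l, 1 ≤ x) :
    ∃ d e, l.length = height l + d ∧ l.sum = l.length + height l + e ∧
      listWeight u v w l = u ^ e * v ^ d * w ^ (2 * height l) := by
  induction l with
  | nil => exact ⟨0, 0, by simp [height, listWeight]⟩
  | cons x l ih =>
    obtain ⟨d, e, h1, h2, h3⟩ := ih fun y hy => hl y (by simp [hy])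
    match x, hl x (by simp) with
    | 1, _ =>
      have hh : height (1 :: l) = height l := by simp [height]
      refine ⟨d + 1, e, ?_, ?_, ?_⟩
      · rw [hh, List.length_cons]
        omega
      · rw [hh, List.length_cons, List.sum_cons]
        omega
      · rw [hh, listWeight_cons, h3, letterWeight]
        ring
    | x + 2, _ =>
      have hh : height ((x + 2) :: l) = height l + 1 := by simp [height]
      refine ⟨d, e + x, ?_, ?_, ?_⟩
      · rw [hh, List.length_cons]
        omega
      · rw [hh, List.length_cons, List.sum_cons]
        omega
      · rw [hh, listWeight_cons, h3, letterWeight]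
        ring

theorem listWeight_eq_zero (u v w : ℝ) {l : List ℕ} (hl : ¬ ∀ x ∈ l, 1 ≤ x) :
    listWeight u v w l = 0 := by
  have h0 : 0 ∈ l := by
    push Not at hl
    obtain ⟨x, hx, hx'⟩ := hl
    rwa [show x = 0 by omega] at hx
  exact List.prod_eq_zero (List.mem_map.2 ⟨0, h0, rfl⟩)

theorem IsAdmissible.height_bounds {l : List ℕ} (hl : IsAdmissible l) :
    l.length + height l ≤ l.sum ∧ height l ≤ l.length ∧ 1 ≤ height l := by
  obtain ⟨d, e, h1, h2, -⟩ := listWeight_eq_of_pos 0 0 0 hl.1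
  refine ⟨by omega, by omega, ?_⟩
  cases l with
  | nil => exact absurd hl.2 (by simp)
  | cons x l =>
    have hx : 2 ≤ x := hl.2
    simp [height, hx]

open Classical in
theorem headWeight_mul_listWeight (u v w : ℝ) (x : ℕ) (l : List ℕ) :
    headWeight u x * listWeight u v w l =
      if IsAdmissible (x :: l) then
        u ^ ((x :: l).sum - (x :: l).length - height (x :: l)) *
          v ^ ((x :: l).length - height (x :: l)) * w ^ (2 * height (x :: l) - 2)
      else 0 := by
  match x with
  | 0 =>
    rw [if_neg fun h => absurd h.2 (by simp)]
    simp [headWeight]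
  | 1 =>
    rw [if_neg fun h => absurd h.2 (by simp)]
    simp [headWeight]
  | x + 2 =>
    by_cases hl : ∀ y ∈ l, 1 ≤ y
    · obtain ⟨d, e, h1, h2, h3⟩ := listWeight_eq_of_pos u v w hl
      have hh : height ((x + 2) :: l) = height l + 1 := by simp [height]
      have hs : ((x + 2) :: l).sum = x + 2 + l.sum := List.sum_cons
      have hn : ((x + 2) :: l).length = l.length + 1 := List.length_cons
      rw [if_pos ⟨by simpa using hl, by simp⟩, h3, headWeight, hh, hs, hn,
        show x + 2 + l.sum - (l.length + 1) - (height l + 1) = x + e by omega,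
        show l.length + 1 - (height l + 1) = d by omega,
        show 2 * (height l + 1) - 2 = 2 * height l by omega]
      ring
    · rw [if_neg fun h => hl fun y hy => h.1 y (by simp [hy]), listWeight_eq_zero u v w hl,
        mul_zero]

theorem Phi0_eq_of_hasSum {N a : ℕ} {r u v w z s : ℝ}
    (h : HasSum (fun p : ℕ × List ℕ =>
      headWeight u p.1 * listWeight u v w p.2 * iLv N a r (p.1 :: p.2) z) s) :
    Phi0 N a r u v w z = s := by
  classical
  set f : List ℕ → ℝ := fun l => if IsAdmissible l then
    iLv N a r l z * u ^ (l.sum - l.length - height l) * v ^ (l.length - height l)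
      * w ^ (2 * height l - 2) else 0 with hf
  have h0 : f [] = 0 := if_neg fun h => absurd h.2 (by simp)
  have h1 : HasSum f s := by
    have := hasSum_list_of_hasSum_cons (f := f) (s := s) (h.of_eq (fun p => ?_) rfl)
    · rwa [h0, zero_add] at this
    · rw [headWeight_mul_listWeight, hf]
      dsimp only
      split_ifs <;> ring
  rw [← (h1.tsum_fiberwise fun l => (l.sum, l.length, height l)).tsum_eq, Phi0]
  refine tsum_congr fun p => ?_
  obtain ⟨k, n, t⟩ := p
  dsimp only
  rw [tsum_subtype ((fun l : List ℕ => (l.sum, l.length, height l)) ⁻¹' {(k, n, t)}) f]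
  have hX : X0z N a r k n t z = ∑' l, {l : List ℕ | IsAdmissible l ∧ l.sum = k ∧ l.length = n ∧
      height l = t}.indicator (fun l => iLv N a r l z) l :=
    tsum_subtype {l : List ℕ | IsAdmissible l ∧ l.sum = k ∧ l.length = n ∧ height l = t}
      (fun l => iLv N a r l z)
  split_ifs with hc
  · rw [hX, ← tsum_mul_right, ← tsum_mul_right, ← tsum_mul_right]
    refine tsum_congr fun l => ?_
    simp only [Set.indicator_apply, Set.mem_ofPred_eq, Set.mem_preimage, Set.mem_singleton_iff,
      Prod.mk.injEq, hf]
    by_cases hl : l.sum = k ∧ l.length = n ∧ height l = t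
    · obtain ⟨rfl, rfl, rfl⟩ := hl
      by_cases ha : IsAdmissible l <;> simp [ha]
    · simp [hl]
  · refine (tsum_zero.symm.trans (tsum_congr fun l => ?_))
    simp only [Set.indicator_apply, Set.mem_preimage, Set.mem_singleton_iff, Prod.mk.injEq, hf]
    split_ifs with h2 h3
    · obtain ⟨rfl, rfl, rfl⟩ := h2
      exact absurd h3.height_bounds hc
    · rfl
    · rfl

theorem summable_mul_pow_mul_pow {c : ℕ → ℝ} {C : ℝ} (hc : ∀ m, |c m| ≤ C) (p : ℕ) {z : ℝ}
    (hz0 : 0 ≤ z) (hz1 : z < 1) : Summable fun m : ℕ => c m * (m : ℝ) ^ p * z ^ m := by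
  refine Summable.of_norm_bounded ((summable_pow_mul_geometric_of_norm_lt_one p
    (by rwa [Real.norm_of_nonneg hz0])).mul_left C) fun m => ?_
  rw [Real.norm_eq_abs, abs_mul, abs_mul, mul_assoc, abs_of_nonneg (by positivity : 0 ≤ (m : ℝ) ^ p),
    abs_of_nonneg (by positivity : 0 ≤ z ^ m)]
  exact mul_le_mul_of_nonneg_right (hc m) (by positivity)

theorem hasDerivAt_tsum_mul_pow_mul_pow {c : ℕ → ℝ} {C : ℝ} (hc : ∀ m, |c m| ≤ C) (p : ℕ) {z : ℝ}
    (hz0 : 0 < z) (hz1 : z < 1) :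
    HasDerivAt (fun t => ∑' m : ℕ, c m * (m : ℝ) ^ p * t ^ m)
      ((∑' m : ℕ, c m * (m : ℝ) ^ (p + 1) * z ^ m) / z) z := by
  obtain ⟨ρ, hzρ, hρ1⟩ := exists_between hz1
  have hρ0 : 0 < ρ := hz0.trans hzρ
  have hpow : ∀ (m : ℕ) (y : ℝ), 0 < y →
      c m * (m : ℝ) ^ p * (m * y ^ (m - 1)) = c m * (m : ℝ) ^ (p + 1) * y ^ m / y := by
    intro m y hy
    cases m with
    | zero => simp
    | succ m =>
      rw [Nat.add_sub_cancel, pow_succ y, pow_succ _ p]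
      field_simp
  have hu : Summable fun m : ℕ => |c m * (m : ℝ) ^ p * (m * ρ ^ (m - 1))| := by
    simp only [hpow _ ρ hρ0]
    exact ((summable_mul_pow_mul_pow hc (p + 1) hρ0.le hρ1).div_const ρ).abs
  have := hasDerivAt_tsum_of_isPreconnected
    (g := fun (m : ℕ) t => c m * (m : ℝ) ^ p * t ^ m)
    (g' := fun (m : ℕ) t => c m * (m : ℝ) ^ p * (m * t ^ (m - 1)))
    (t := Set.Ioo 0 ρ) (y₀ := z) (y := z) hu isOpen_Ioo isPreconnected_Ioo
    (fun m y _ => (hasDerivAt_pow m y).const_mul _)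
    (fun m y hy => ?_) ⟨hz0, hzρ⟩ (summable_mul_pow_mul_pow hc p hz0.le hz1) ⟨hz0, hzρ⟩
  · simpa only [hpow _ z hz0, tsum_div_const] using this
  · rw [Real.norm_eq_abs, abs_mul, abs_mul (c m * (m : ℝ) ^ p)]
    refine mul_le_mul_of_nonneg_left ?_ (abs_nonneg _)
    rw [abs_of_nonneg (mul_nonneg m.cast_nonneg (pow_nonneg hy.1.le _)),
      abs_of_nonneg (by positivity)]
    exact mul_le_mul_of_nonneg_left (pow_le_pow_left₀ hy.1.le hy.2.le _) m.cast_nonneg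

theorem hasSum_headWeight_mul_listWeight {N a m : ℕ} {r u v w H : ℝ} (z : ℝ) (hu : |u| < 1)
    (hH : HasSum (fun l => listWeight u v w l * interpSum (residueInv N a) r l m) H) :
    HasSum (fun p : ℕ × List ℕ => z ^ m * (headWeight u p.1 * residueInv N a m p.1 *
      (listWeight u v w p.2 * interpSum (residueInv N a) r p.2 m)))
      (headSum N a u m * H * z ^ m) :=
  (hasSum_headWeight N a hu m).const_mul_prod hH (z ^ m)

set_option maxHeartbeats 1000000 in
theorem exists_Phi0_coefficients (N a : ℕ) {r u v w ε : ℝ} (hε : ε ≤ 1 / 12)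
    (hrε : |r| * (12 * ε) ≤ 1) (hu : |u| ≤ ε) (hv : |v| ≤ ε) (hw : |w| ≤ ε) :
    ∃ F : ℕ → ℝ,
      (∀ m : ℕ, |headSum N a u m * F m| ≤ 8) ∧
      (∀ m, F m = 1 + (∑ m' ∈ range m, letterSum N a u v w m' * F m'
        + r * (letterSum N a u v w m * F m))) ∧
      ∀ z, 0 ≤ z → z < 1 → Phi0 N a r u v w z = ∑' m : ℕ, headSum N a u m * F m * z ^ m := by
  have hu1 : |u| < 1 := by linarith
  have hu1' : |(|u|)| < 1 := by rwa [abs_abs]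
  have hle := letterSum_mul_le (N := N) (a := a) hε (abs_nonneg u) (abs_nonneg w) hu hv hw
  have hχ := residueInv_nonneg N a
  choose G hG hGle using hasSum_listWeight_mul_interpSum_of_nonneg hχ (abs_nonneg r)
    (abs_nonneg u) (abs_nonneg v) (abs_nonneg w) (hasSum_letterWeight N a hu1' |v| |w|)
    (fun m => (hle m).trans (by linarith))
    (fun m => (mul_le_mul_of_nonneg_left (hle m) (abs_nonneg r)).trans hrε)
  have hterm : ∀ l m, |listWeight u v w l * interpSum (residueInv N a) r l m|
      ≤ listWeight |u| |v| |w| l * interpSum (residueInv N a) |r| l m := fun l m => by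
    rw [abs_mul, abs_listWeight]
    refine mul_le_mul_of_nonneg_left (abs_interpSum_le hχ r l m) ?_
    rw [← abs_listWeight]
    exact abs_nonneg _
  have hsum : ∀ m, Summable fun l => listWeight u v w l * interpSum (residueInv N a) r l m :=
    fun m => Summable.of_norm_bounded (hG m).summable fun l => hterm l m
  set F : ℕ → ℝ := fun m => ∑' l, listWeight u v w l * interpSum (residueInv N a) r l m with hFdef
  have hF : ∀ m, HasSum (fun l => listWeight u v w l * interpSum (residueInv N a) r l m) (F m) :=
    fun m => (hsum m).hasSum
  have hFG : ∀ m, |F m| ≤ G m := fun m =>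
    tsum_of_norm_bounded
      (f := fun l => listWeight u v w l * interpSum (residueInv N a) r l m) (hG m) fun l => hterm l m
  have hG0 : ∀ m, 0 ≤ G m := fun m => (abs_nonneg _).trans (hFG m)
  refine ⟨F, fun m => ?_, fun m => ?_, fun z hz0 hz1 => ?_⟩
  · obtain ⟨h1, h2⟩ := headSum_mul_le (N := N) (a := a) (u := u)
      (by linarith [le_abs_self u]) m
    rw [abs_mul, abs_of_nonneg h1]
    exact (mul_le_mul_of_nonneg_left ((hFG m).trans (hGle m)) h1).trans h2
  · refine (hF m).unique ?_
    refine (hasSum_list_of_hasSum_cons (f := fun l =>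
      listWeight u v w l * interpSum (residueInv N a) r l m)
      ((hasSum_cons_interpSum (hasSum_letterWeight N a hu1 v w) hF m).of_eq
        (fun p => ?_) rfl)).of_eq (fun l => rfl) ?_
    · rw [listWeight_cons]
    · simp [listWeight, interpSum]
  · refine Phi0_eq_of_hasSum ?_
    have hbar : Summable fun q : ℕ × (ℕ × List ℕ) => z ^ q.1 * (headWeight |u| q.2.1 *
        residueInv N a q.1 q.2.1 * (listWeight |u| |v| |w| q.2.2 *
          interpSum (residueInv N a) |r| q.2.2 q.1)) := by
      have hs : Summable fun m : ℕ => headSum N a |u| m * G m * z ^ m := by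
        have := summable_mul_pow_mul_pow (c := fun m => headSum N a |u| m * G m) (C := 8)
          (fun m => ?_) 0 hz0 hz1
        · simpa using this
        · obtain ⟨h1, h2⟩ := headSum_mul_le (N := N) (a := a) (u := |u|) (by linarith) m
          rw [abs_mul, abs_of_nonneg h1, abs_of_nonneg (hG0 m)]
          exact (mul_le_mul_of_nonneg_left (hGle m) h1).trans h2
      refine (hasSum_prod_of_nonneg (fun q => ?_) (fun m => hasSum_headWeight_mul_listWeight z hu1' (hG m)) hs.hasSum).summable
      refine mul_nonneg (by positivity) (mul_nonneg (mul_nonneg ?_ (hχ _ _))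
        (mul_nonneg ?_ (interpSum_nonneg hχ (abs_nonneg r) _ _)))
      · rw [← abs_headWeight]
        exact abs_nonneg _
      · rw [← abs_listWeight]
        exact abs_nonneg _
    have hall : Summable fun q : ℕ × (ℕ × List ℕ) => z ^ q.1 * (headWeight u q.2.1 *
        residueInv N a q.1 q.2.1 * (listWeight u v w q.2.2 *
          interpSum (residueInv N a) r q.2.2 q.1)) := by
      refine Summable.of_norm_bounded hbar fun q => ?_
      rw [Real.norm_eq_abs, abs_mul, abs_mul (_ * _), abs_mul (headWeight _ _), abs_headWeight,
        abs_of_nonneg (pow_nonneg hz0 _), abs_of_nonneg (hχ _ _)]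
      refine mul_le_mul_of_nonneg_left (mul_le_mul_of_nonneg_left (hterm _ _)
        (mul_nonneg ?_ (hχ _ _))) (pow_nonneg hz0 _)
      rw [← abs_headWeight]
      exact abs_nonneg _
    have h1 := hall.hasSum.prod_fiberwise (fun m => hasSum_headWeight_mul_listWeight z hu1 (hF m))
    rw [h1.tsum_eq]
    refine ((Equiv.prodComm _ _).hasSum_iff.2 hall.hasSum).prod_fiberwise fun p => ?_
    refine ((hasSum_iLv N a r p.1 p.2 hz0 hz1).mul_left
      (headWeight u p.1 * listWeight u v w p.2)).of_eq (fun m => ?_) rfl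
    simp only [Function.comp_apply, Equiv.prodComm_apply, Prod.swap_prod_mk]
    ring

theorem coefficient_recurrence {N a : ℕ} (hN : 1 ≤ N) (ha1 : 1 ≤ a) (ha2 : a ≤ N)
    {r u v w : ℝ} (hu : u < 1) {F : ℕ → ℝ}
    (hF : ∀ m, F m = 1 + (∑ m' ∈ range m, letterSum N a u v w m' * F m'
        + r * (letterSum N a u v w m * F m))) (m : ℕ) :
    (m * (m - u) - r * (v * m - (u * v - w ^ 2))) * (headSum N a u m * F m)
      = (if m = a then 1 else 0) + if N ≤ m then
        (((m - N : ℕ) : ℝ) * ((m - N : ℕ) - u) + (1 - r) * (v * (m - N : ℕ) - (u * v - w ^ 2))) *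
          (headSum N a u (m - N) * F (m - N)) else 0 := by
  set E : ℕ → ℝ := fun m => 1 + ∑ m' ∈ range m, letterSum N a u v w m' * F m' with hE
  have hP : ∀ m, (0 < m ∧ m % N = a % N) →
      ((m : ℝ) * (m - u) - r * (v * m - (u * v - w ^ 2))) * (headSum N a u m * F m) = E m ∧
      ((m : ℝ) * (m - u) + (1 - r) * (v * m - (u * v - w ^ 2))) * (headSum N a u m * F m)
        = E m + letterSum N a u v w m * F m := by
    intro m hm
    have hm1 : (1 : ℝ) ≤ m := by exact_mod_cast hm.1
    have hm0 : (m : ℝ) ≠ 0 := by linarith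
    have hmu : (m : ℝ) - u ≠ 0 := by linarith
    have hEm : E m = F m - r * (letterSum N a u v w m * F m) := by
      rw [hE]
      linarith [hF m]
    rw [hEm, letterSum, headSum, if_pos hm, if_pos hm]
    constructor <;> field_simp <;> ring
  have hEone : ∀ m, (∀ k < m, ¬ (0 < k ∧ k % N = a % N)) → E m = 1 := by
    intro m hm
    rw [hE]
    dsimp only
    rw [sum_eq_zero fun k hk => ?_, add_zero]
    rw [letterSum, if_neg (hm k (mem_range.1 hk)), zero_mul]
  have hzero : ∀ m, ¬ (0 < m ∧ m % N = a % N) → headSum N a u m * F m = 0 := fun m hm => by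
    rw [headSum, if_neg hm, zero_mul]
  have hlow : ∀ k, (0 < k ∧ k % N = a % N) → k ≤ N → k = a := by
    rintro k ⟨hk0, hk⟩ hkN
    rcases hkN.lt_or_eq with hlt | rfl
    · rw [Nat.mod_eq_of_lt hlt] at hk
      rcases ha2.lt_or_eq with hlt' | rfl
      · rwa [Nat.mod_eq_of_lt hlt'] at hk
      · rw [Nat.mod_self] at hk
        omega
    · rw [Nat.mod_self] at hk
      exact Nat.le_antisymm (Nat.le_of_dvd ha1 (Nat.dvd_of_mod_eq_zero hk.symm)) ha2
  have hEa : E a = 1 := hEone a fun k hk hcl => hk.ne (hlow k hcl (hk.le.trans ha2))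
  by_cases hNm : N ≤ m
  · obtain ⟨k, rfl⟩ := Nat.exists_eq_add_of_le' hNm
    rw [if_pos hNm, Nat.add_sub_cancel]
    by_cases hcl : 0 < k ∧ k % N = a % N
    · have hcl' : 0 < k + N ∧ (k + N) % N = a % N := ⟨by omega, by simpa using hcl.2⟩
      rw [(hP _ hcl').1, (hP _ hcl).2, if_neg (by omega), zero_add, hE]
      dsimp only
      rw [sum_range_add, sum_eq_single (s := range N) 0, add_zero, add_assoc]
      · intro x hx hx0
        rw [letterSum, if_neg, zero_mul]
        rintro ⟨-, h⟩
        have h2 : k + x ≡ k + 0 [MOD N] := by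
          rw [add_zero]
          exact h.trans hcl.2.symm
        have h3 : x % N = 0 % N := Nat.ModEq.add_left_cancel' k h2
        rw [Nat.mod_eq_of_lt (mem_range.1 hx), Nat.zero_mod] at h3
        exact hx0 h3
      · intro h
        exact absurd (mem_range.2 (by omega)) h
    · rw [hzero k hcl, mul_zero, add_zero]
      by_cases hka : k + N = a
      · rw [if_pos hka, hka, ← hEa]
        exact (hP a ⟨by omega, rfl⟩).1
      · rw [if_neg hka, hzero, mul_zero]
        rintro ⟨-, h⟩
        rw [Nat.add_mod_right] at h
        rcases Nat.eq_zero_or_pos k with rfl | hk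
        · exact hka (hlow _ ⟨by omega, by simpa using h⟩ (by omega))
        · exact hcl ⟨hk, h⟩
  · rw [if_neg hNm, add_zero]
    by_cases hma : m = a
    · rw [if_pos hma, hma, ← hEa]
      exact (hP a ⟨by omega, rfl⟩).1
    · rw [if_neg hma, hzero, mul_zero]
      exact fun h => hma (hlow m h (by omega))

end

/-- The generating function `Φ₀^r(u,v,w;z)` is twice differentiable on `0 < z < 1` and
satisfies the differential equation
`z²(1-z^N)Φ₀'' + z[(1-u)(1-z^N) - v(r+(1-r)z^N)]Φ₀' + (r+(1-r)z^N)(uv-w²)Φ₀ = z^a`. -/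
theorem stmt1 (N : ℕ) (hN : 1 ≤ N) (a : ℕ) (ha1 : 1 ≤ a) (ha2 : a ≤ N) (r : ℝ) :
    ∃ ε > (0 : ℝ), ∀ u v w : ℝ, |u| < ε → |v| < ε → |w| < ε →
      ∀ z : ℝ, 0 < z → z < 1 →
        DifferentiableAt ℝ (fun t => Phi0 N a r u v w t) z ∧
        DifferentiableAt ℝ (deriv (fun t => Phi0 N a r u v w t)) z ∧
        z ^ 2 * (1 - z ^ N) * deriv (deriv (fun t => Phi0 N a r u v w t)) z
          + z * ((1 - u) * (1 - z ^ N) - v * (r + (1 - r) * z ^ N))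
            * deriv (fun t => Phi0 N a r u v w t) z
          + (r + (1 - r) * z ^ N) * (u * v - w ^ 2) * Phi0 N a r u v w z
          = z ^ a := by

  have hr1 : 0 < 12 * (1 + |r|) := by positivity
  refine ⟨1 / (12 * (1 + |r|)), by positivity, fun u v w hu hv hw z hz0 hz1 => ?_⟩
  have hε : 1 / (12 * (1 + |r|)) ≤ 1 / 12 :=
    one_div_le_one_div_of_le (by norm_num) (by linarith [abs_nonneg r])
  have hrε : |r| * (12 * (1 / (12 * (1 + |r|)))) ≤ 1 := by
    rw [show |r| * (12 * (1 / (12 * (1 + |r|)))) = |r| / (1 + |r|) by field_simp,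
      div_le_one (by positivity)]
    linarith
  obtain ⟨F, hc, hF, hΦ⟩ := exists_Phi0_coefficients N a hε hrε hu.le hv.le hw.le
  set c : ℕ → ℝ := fun m => headSum N a u m * F m with hcdef
  set S : ℕ → ℝ → ℝ := fun p t => ∑' m : ℕ, c m * (m : ℝ) ^ p * t ^ m with hS
  have hΦS : ∀ t, 0 < t → t < 1 → Phi0 N a r u v w t = S 0 t := fun t h0 h1 => by
    simp [hΦ t h0.le h1, hS, hcdef]
  have hdS : ∀ p t, 0 < t → t < 1 → HasDerivAt (S p) (S (p + 1) t / t) t := fun p t h0 h1 =>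
    hasDerivAt_tsum_mul_pow_mul_pow hc p h0 h1
  have hd1 : ∀ t, 0 < t → t < 1 →
      HasDerivAt (fun t => Phi0 N a r u v w t) (S 1 t / t) t := fun t h0 h1 => by
    refine (hdS 0 t h0 h1).congr_of_eventuallyEq ?_
    filter_upwards [Ioo_mem_nhds h0 h1] with y hy using hΦS y hy.1 hy.2
  have hd2 : HasDerivAt (deriv fun t => Phi0 N a r u v w t)
      ((S 2 z / z * z - S 1 z * 1) / z ^ 2) z := by
    refine ((hdS 1 z hz0 hz1).div (hasDerivAt_id z) hz0.ne').congr_of_eventuallyEq ?_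
    filter_upwards [Ioo_mem_nhds hz0 hz1] with y hy using (hd1 y hy.1 hy.2).deriv
  refine ⟨(hd1 z hz0 hz1).differentiableAt, hd2.differentiableAt, ?_⟩
  rw [hd2.deriv, (hd1 z hz0 hz1).deriv, hΦS z hz0 hz1]
  have hsum : ∀ p, HasSum (fun m : ℕ => c m * (m : ℝ) ^ p * z ^ m) (S p z) := fun p =>
    (summable_mul_pow_mul_pow hc p hz0.le hz1).hasSum
  have hcomb : ∀ α β γ : ℝ, HasSum (fun m : ℕ =>
      (α * (m : ℝ) ^ 2 + β * m + γ) * c m * z ^ m) (α * S 2 z + β * S 1 z + γ * S 0 z) :=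
    fun α β γ => ((((hsum 2).mul_left α).add ((hsum 1).mul_left β)).add
      ((hsum 0).mul_left γ)).of_eq (fun m => by ring) rfl
  set Q : ℕ → ℝ := fun m =>
    ((m : ℝ) * (m - u) + (1 - r) * (v * m - (u * v - w ^ 2))) * c m with hQ
  have hshift : HasSum (fun m => if N ≤ m then Q (m - N) * z ^ m else 0)
      (z ^ N * (1 * S 2 z + (-u + (1 - r) * v) * S 1 z + -(1 - r) * (u * v - w ^ 2) * S 0 z)) := by
    refine ((add_left_injective N).hasSum_iff fun m hm => ?_).1
      (((hcomb 1 (-u + (1 - r) * v) (-(1 - r) * (u * v - w ^ 2))).mul_left (z ^ N)).of_eq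
        (fun m => ?_) rfl)
    · exact if_neg fun h => hm ⟨m - N, Nat.sub_add_cancel h⟩
    · simp only [Function.comp_apply, Nat.le_add_left, if_true, Nat.add_sub_cancel, hQ, pow_add]
      ring
  have hkey : 1 * S 2 z + (-u - r * v) * S 1 z + r * (u * v - w ^ 2) * S 0 z = z ^ a +
      z ^ N * (1 * S 2 z + (-u + (1 - r) * v) * S 1 z + -(1 - r) * (u * v - w ^ 2) * S 0 z) := by
    refine (hcomb 1 (-u - r * v) (r * (u * v - w ^ 2))).unique
      (((hasSum_ite_eq a (z ^ a)).add hshift).of_eq (fun m => ?_) rfl)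
    have h := coefficient_recurrence hN ha1 ha2 (by linarith [le_abs_self u]) hF m
    calc _ = (m * (m - u) - r * (v * m - (u * v - w ^ 2))) * (headSum N a u m * F m) * z ^ m := by
          rw [hcdef]
          ring
      _ = _ := by
          rw [h, add_mul, ite_mul, ite_mul, one_mul, zero_mul]
          by_cases hma : m = a <;> simp [hma, hQ, hcdef]
  have e1 : z ^ 2 * ((S 2 z / z * z - S 1 z * 1) / z ^ 2) = S 2 z - S 1 z := by
    field_simp
  have e2 : z * (S 1 z / z) = S 1 z := by field_simp
  linear_combination hkey + (1 - z ^ N) * e1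
    + ((1 - u) * (1 - z ^ N) - v * (r + (1 - r) * z ^ N)) * e2
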